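/- Let R_1, R_2 be reduced words for the longest element w_0 ∈ S_n that differ by a single braid move. Then there is exactly one triple (a,b,c) with 1 ≤ a < b < c ≤ n such that T_{R_1}(a,b,c) ≠ T_{R_2}(a,b,c); for all other triples the two values agree. -/

import Mathlib

open scoped Classical

namespace BSDist

/-- The simple transposition `s i` (1-indexed): it swaps the values `i` and `i+1`
of `{1,…,n}`, i.e. the elements `i-1` and `i` of `Fin n`.  Out-of-range letters
give the identity. -/
def sTr (n : ℕ) (i : ℕ) : Equiv.Perm (Fin n) :=
  if h : 1 ≤ i ∧ i < n then Equiv.swap ⟨i - 1, by omega⟩ ⟨i, h.2⟩ else 1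

/-- The product `w(R) = s_{i₁} ⋯ s_{i_L}` of a word. -/
def wprod (n : ℕ) (R : List ℕ) : Equiv.Perm (Fin n) := (R.map (sTr n)).prod

/-- The Coxeter length of a permutation: its number of inversions. -/
def len {n : ℕ} (w : Equiv.Perm (Fin n)) : ℕ :=
  (Finset.univ.filter (fun p : Fin n × Fin n => p.1 < p.2 ∧ w p.2 < w p.1)).card

/-- A word over the alphabet `{1,…,n-1}`. -/
def Alphabet (n : ℕ) (R : List ℕ) : Prop := ∀ i ∈ R, 1 ≤ i ∧ i < n

/-- `R` is a reduced word (over the alphabet `{1,…,n-1}`). -/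
def IsReducedWord (n : ℕ) (R : List ℕ) : Prop :=
  Alphabet n R ∧ R.length = len (wprod n R)

/-- `R` is a reduced word for `w`. -/
def IsReducedWordFor (n : ℕ) (R : List ℕ) (w : Equiv.Perm (Fin n)) : Prop :=
  IsReducedWord n R ∧ wprod n R = w

/-- The weight `wt_R : S_n → ℤ[q]`, defined by the recursion
`wt_∅(e) = 1`, `wt_∅(x) = 0` for `x ≠ e`, and for an appended letter `i`:
`wt_{Ri}(x) = wt_R(x) + wt_R(x sᵢ)` if `ℓ(x sᵢ) > ℓ(x)`, and
`wt_{Ri}(x) = q·wt_R(x) + q·wt_R(x sᵢ)` if `ℓ(x sᵢ) < ℓ(x)`. -/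
noncomputable def wt (n : ℕ) (R : List ℕ) : Equiv.Perm (Fin n) → Polynomial ℤ :=
  R.foldl
    (fun f i x =>
      if len x < len (x * sTr n i) then f x + f (x * sTr n i)
      else Polynomial.X * f x + Polynomial.X * f (x * sTr n i))
    (fun x => if x = 1 then 1 else 0)

/-- A single commutation move: replace a consecutive factor `ij` by `ji` where
`|i - j| > 1`. -/
def CommMove (R R' : List ℕ) : Prop :=
  ∃ (A B : List ℕ) (i j : ℕ), (i + 1 < j ∨ j + 1 < i) ∧
    R = A ++ [i, j] ++ B ∧ R' = A ++ [j, i] ++ B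

/-- Commutation equivalence: a finite sequence of commutation moves. -/
def CommEquiv (R R' : List ℕ) : Prop := Relation.ReflTransGen CommMove R R'

/-- A single braid move: replace a consecutive factor `k(k+1)k` by `(k+1)k(k+1)`. -/
def BraidMove (R R' : List ℕ) : Prop :=
  ∃ (A B : List ℕ) (k : ℕ),
    R = A ++ [k, k + 1, k] ++ B ∧ R' = A ++ [k + 1, k, k + 1] ++ B

/-- The Demazure product of a word, computed left to right:
`w ∗ sᵢ = w sᵢ` if `ℓ(w sᵢ) > ℓ(w)`, and `w ∗ sᵢ = w` otherwise. -/
def dem (n : ℕ) (R : List ℕ) : Equiv.Perm (Fin n) :=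
  R.foldl (fun w i => if len w < len (w * sTr n i) then w * sTr n i else w) 1

/-- `app w t` is the value `w(t)` in 1-indexed one-line notation:
positions and values both run through `{1,…,n}`. -/
def app {n : ℕ} (w : Equiv.Perm (Fin n)) (t : ℕ) : ℕ :=
  if h : 1 ≤ t ∧ t ≤ n then ((w ⟨t - 1, by omega⟩ : Fin n) : ℕ) + 1 else 0

/-- `posOf x t = x⁻¹(t)`, the (1-indexed) position of the value `t` in `x`. -/
def posOf {n : ℕ} (x : Equiv.Perm (Fin n)) (t : ℕ) : ℕ := app x⁻¹ t

/-- The longest element `w₀` of `S_n` (the order-reversing permutation). -/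
def w0 (n : ℕ) : Equiv.Perm (Fin n) := ⟨Fin.rev, Fin.rev, Fin.rev_rev, Fin.rev_rev⟩

/-- The value pair `(a,b)` (with `a < b`) is an inversion of `x`:
`x⁻¹(a) > x⁻¹(b)`. -/
def IsInversion {n : ℕ} (x : Equiv.Perm (Fin n)) (a b : ℕ) : Prop :=
  posOf x b < posOf x a

/-- `tau R a b` is the first time `k` at which the pair `(a,b)` is an inversion
of the prefix product `s_{i₁} ⋯ s_{i_k}`. -/
noncomputable def tau (n : ℕ) (R : List ℕ) (a b : ℕ) : ℕ :=
  sInf {k | IsInversion (wprod n (R.take k)) a b}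

/-- `T_R(a,b,c) = +1` if `τ_R(a,b) < τ_R(b,c)` and `-1` otherwise. -/
noncomputable def T (n : ℕ) (R : List ℕ) (a b c : ℕ) : ℤ :=
  if tau n R a b < tau n R b c then 1 else -1

/-- `Supp(x) = {t : pos_x(t) ≠ pos_{w₀}(t)}`. -/
noncomputable def Supp (n : ℕ) (x : Equiv.Perm (Fin n)) : Finset ℕ :=
  (Finset.Icc 1 n).filter (fun t => posOf x t ≠ posOf (w0 n) t)

/-- `Fwd(x) = {t : pos_x(t) < pos_{w₀}(t)}`. -/
noncomputable def Fwd (n : ℕ) (x : Equiv.Perm (Fin n)) : Finset ℕ :=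
  (Finset.Icc 1 n).filter (fun t => posOf x t < posOf (w0 n) t)

/-- `Bwd(x) = {t : pos_x(t) > pos_{w₀}(t)}`. -/
noncomputable def Bwd (n : ℕ) (x : Equiv.Perm (Fin n)) : Finset ℕ :=
  (Finset.Icc 1 n).filter (fun t => posOf (w0 n) t < posOf x t)

/-- `D_R(x)`: the coefficient of `q^{N-1}` in `wt_R(x)`, where `N = n(n-1)/2`. -/
noncomputable def D (n : ℕ) (R : List ℕ) (x : Equiv.Perm (Fin n)) : ℤ :=
  (wt n R x).coeff (n * (n - 1) / 2 - 1)

/-- `σ_b(x) = sign(pos_x(b) − pos_{w₀}(b)) ∈ {−1,0,+1}`. -/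
noncomputable def sigmaVal (n : ℕ) (b : ℕ) (x : Equiv.Perm (Fin n)) : ℤ :=
  Int.sign ((posOf x b : ℤ) - (posOf (w0 n) b : ℤ))

/-- `Θ_R(a,b,c) = Σ_{x : Supp(x) = [a,c]} D_R(x)·σ_b(x)`. -/
noncomputable def Theta (n : ℕ) (R : List ℕ) (a b c : ℕ) : ℤ :=
  ∑ x ∈ Finset.univ.filter (fun x : Equiv.Perm (Fin n) => Supp n x = Finset.Icc a c),
    D n R x * sigmaVal n b x

end BSDist

set_option linter.unusedSimpArgs false

namespace BSDist

/-- Adjacent transpositions preserve the order of all pairs but one. -/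
lemma swap_lt {n : ℕ} {e f : Fin n} (hef : f.val = e.val + 1) {p q : Fin n} (hpq : p < q)
    (hne : ¬ (p = e ∧ q = f)) : Equiv.swap e f p < Equiv.swap e f q := by
  simp only [Equiv.swap_apply_def, Fin.ext_iff, Fin.lt_def] at *
  split_ifs <;> omega

lemma apply_inv_self_aux {n : ℕ} (w : Equiv.Perm (Fin n)) (x : Fin n) : w (w⁻¹ x) = x := by
  simp

lemma inv_apply_self_aux {n : ℕ} (w : Equiv.Perm (Fin n)) (x : Fin n) : w⁻¹ (w x) = x := by
  simp

lemma braid_swap {n : ℕ} {e f g : Fin n} (hef : e ≠ f) (hfg : f ≠ g) (heg : e ≠ g) :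
    Equiv.swap e f * (Equiv.swap f g * Equiv.swap e f) =
        Equiv.swap f g * (Equiv.swap e f * Equiv.swap f g) := by
  ext x
  by_cases h1 : x = e
  · subst h1
    simp [Equiv.swap_apply_of_ne_of_ne, hef, hfg, heg, hef.symm, hfg.symm, heg.symm]
  by_cases h2 : x = f
  · subst h2
    simp [Equiv.swap_apply_of_ne_of_ne, hef, hfg, heg, hef.symm, hfg.symm, heg.symm]
  by_cases h3 : x = g
  · subst h3
    simp [Equiv.swap_apply_of_ne_of_ne, hef, hfg, heg, hef.symm, hfg.symm, heg.symm]
  simp [Equiv.swap_apply_of_ne_of_ne, h1, h2, h3]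

/-- An adjacent swap preserves the order of any two elements other than the swapped pair. -/
lemma swap_lt_iff {n : ℕ} {e f : Fin n} (hef : f.val = e.val + 1) {p q : Fin n}
    (h1 : ¬ (p = e ∧ q = f)) (h2 : ¬ (p = f ∧ q = e)) :
    Equiv.swap e f p < Equiv.swap e f q ↔ p < q := by
  simp only [Equiv.swap_apply_def, Fin.ext_iff, Fin.lt_def] at *
  split_ifs <;> omega

lemma swap_lt_iff_two {n : ℕ} {e f g : Fin n} (hef : f.val = e.val + 1) (hfg : g.val = f.val + 1)
    {p q : Fin n} (h1 : ¬ (p = e ∧ q = f)) (h2 : ¬ (p = f ∧ q = e))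
    (h3 : ¬ (p = e ∧ q = g)) (h4 : ¬ (p = g ∧ q = e)) :
    Equiv.swap f g (Equiv.swap e f p) < Equiv.swap f g (Equiv.swap e f q) ↔ p < q := by
  have hge : g ≠ e := by intro h; rw [h] at hfg; omega
  have hgf : g ≠ f := by intro h; rw [h] at hfg; omega
  rw [swap_lt_iff hfg, swap_lt_iff hef h1 h2]
  all_goals
    rw [Equiv.swap_apply_eq_iff, Equiv.swap_apply_eq_iff, Equiv.swap_apply_right,
      Equiv.swap_apply_of_ne_of_ne hge hgf]
    assumption

lemma swap_lt_iff_two_rev {n : ℕ} {e f g : Fin n} (hef : f.val = e.val + 1)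
    (hfg : g.val = f.val + 1)
    {p q : Fin n} (h1 : ¬ (p = f ∧ q = g)) (h2 : ¬ (p = g ∧ q = f))
    (h3 : ¬ (p = e ∧ q = g)) (h4 : ¬ (p = g ∧ q = e)) :
    Equiv.swap e f (Equiv.swap f g p) < Equiv.swap e f (Equiv.swap f g q) ↔ p < q := by
  have hef' : e ≠ f := by intro h; rw [h] at hef; omega
  have heg : e ≠ g := by intro h; rw [h] at hef; omega
  rw [swap_lt_iff hef, swap_lt_iff hfg h1 h2]
  all_goals
    rw [Equiv.swap_apply_eq_iff, Equiv.swap_apply_eq_iff, Equiv.swap_apply_left,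
      Equiv.swap_apply_of_ne_of_ne hef' heg]
    assumption

lemma swap_lt_iff_three {n : ℕ} {e f g : Fin n} (hef : f.val = e.val + 1)
    (hfg : g.val = f.val + 1)
    {p q : Fin n} (h1 : ¬ (p = e ∧ q = f)) (h2 : ¬ (p = f ∧ q = e))
    (h3 : ¬ (p = e ∧ q = g)) (h4 : ¬ (p = g ∧ q = e))
    (h5 : ¬ (p = f ∧ q = g)) (h6 : ¬ (p = g ∧ q = f)) :
    Equiv.swap e f (Equiv.swap f g (Equiv.swap e f p)) <
      Equiv.swap e f (Equiv.swap f g (Equiv.swap e f q)) ↔ p < q := by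
  have hge : g ≠ e := by intro h; rw [h] at hfg; omega
  have hgf : g ≠ f := by intro h; rw [h] at hfg; omega
  rw [swap_lt_iff_two_rev hef hfg, swap_lt_iff hef h1 h2]
  all_goals
    rw [Equiv.swap_apply_eq_iff, Equiv.swap_apply_eq_iff]
    simp only [Equiv.swap_apply_right, Equiv.swap_apply_left, Equiv.swap_apply_of_ne_of_ne hge hgf]
    assumption

lemma len_mul_swap_le {n : ℕ} (w : Equiv.Perm (Fin n)) {e f : Fin n} (hef : f.val = e.val + 1) :
    len (w * Equiv.swap e f) ≤ len w + 1 := by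
  unfold len
  refine le_trans (Finset.card_le_card (t := insert (e, f)
    ((Finset.univ.filter (fun p : Fin n × Fin n => p.1 < p.2 ∧ w p.2 < w p.1)).image
      (fun p => (Equiv.swap e f p.1, Equiv.swap e f p.2)))) ?_)
    (le_trans (Finset.card_insert_le _ _) (Nat.add_le_add_right Finset.card_image_le 1))
  rintro ⟨p, q⟩ h
  replace h := (Finset.mem_filter.1 h).2
  simp only [Equiv.Perm.mul_apply] at h
  by_cases hc : p = e ∧ q = f
  · simp [hc.1, hc.2]
  · refine Finset.mem_insert_of_mem (Finset.mem_image.2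
      ⟨(Equiv.swap e f p, Equiv.swap e f q), ?_, by simp⟩)
    simp only [Finset.mem_filter, Finset.mem_univ, true_and]
    exact ⟨swap_lt hef h.1 hc, h.2⟩

lemma len_mul_swap_le_of_descent {n : ℕ} (w : Equiv.Perm (Fin n)) {e f : Fin n}
    (hef : f.val = e.val + 1) (hd : w f < w e) :
    len (w * Equiv.swap e f) ≤ len w := by
  unfold len
  refine le_trans (Finset.card_le_card (t :=
    ((Finset.univ.filter (fun p : Fin n × Fin n => p.1 < p.2 ∧ w p.2 < w p.1)).image
      (fun p => (Equiv.swap e f p.1, Equiv.swap e f p.2)))) ?_) Finset.card_image_le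
  rintro ⟨p, q⟩ h
  replace h := (Finset.mem_filter.1 h).2
  simp only [Equiv.Perm.mul_apply] at h
  by_cases hc : p = e ∧ q = f
  · obtain ⟨rfl, rfl⟩ := hc
    simp only [Equiv.swap_apply_left, Equiv.swap_apply_right] at h
    exact absurd h.2 (not_lt.2 hd.le)
  · refine Finset.mem_image.2
      ⟨(Equiv.swap e f p, Equiv.swap e f q), ?_, by simp⟩
    simp only [Finset.mem_filter, Finset.mem_univ, true_and]
    exact ⟨swap_lt hef h.1 hc, h.2⟩

lemma wprod_append (n : ℕ) (A B : List ℕ) : wprod n (A ++ B) = wprod n A * wprod n B := by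
  simp [wprod]

lemma wprod_singleton (n : ℕ) (i : ℕ) : wprod n [i] = sTr n i := by
  simp [wprod]

lemma sTr_eq {n i : ℕ} (h1 : 1 ≤ i) (h2 : i < n) :
    sTr n i = Equiv.swap ⟨i - 1, by omega⟩ ⟨i, h2⟩ := by
  unfold sTr
  rw [dif_pos ⟨h1, h2⟩]

lemma len_one (n : ℕ) : len (1 : Equiv.Perm (Fin n)) = 0 := by
  unfold len
  rw [Finset.card_eq_zero, Finset.filter_eq_empty_iff]
  rintro ⟨p, q⟩ - ⟨h1, h2⟩
  exact absurd h1 (not_lt.2 (le_of_lt h2))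

lemma len_append_le (n : ℕ) (A B : List ℕ) (hB : Alphabet n B) :
    len (wprod n (A ++ B)) ≤ len (wprod n A) + B.length := by
  induction B generalizing A with
  | nil => simp
  | cons i B ih =>
    have h := ih (A ++ [i]) (fun j hj => hB j (List.mem_cons_of_mem _ hj))
    have hi := hB i List.mem_cons_self
    rw [List.append_assoc, List.singleton_append] at h
    have h2 : len (wprod n (A ++ [i])) ≤ len (wprod n A) + 1 := by
      rw [wprod_append, wprod_singleton, sTr_eq hi.1 hi.2]
      apply len_mul_swap_le
      simp only
      omega
    simp only [List.length_cons]
    omega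

lemma len_le (n : ℕ) (A : List ℕ) (hA : Alphabet n A) : len (wprod n A) ≤ A.length := by
  have := len_append_le n [] A hA
  simpa [wprod, len_one] using this

/-- In a reduced word each letter is an ascent. -/
lemma ascent {n : ℕ} {R : List ℕ} (hR : IsReducedWord n R) (A B : List ℕ) (i : ℕ)
    (h : R = A ++ i :: B) (h1 : 1 ≤ i) (h2 : i < n) :
    wprod n A ⟨i - 1, by omega⟩ < wprod n A ⟨i, h2⟩ := by
  obtain ⟨hal, hl⟩ := hR
  by_contra hcon
  have hne : wprod n A ⟨i, h2⟩ ≠ wprod n A ⟨i - 1, by omega⟩ := by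
    intro h
    have := (wprod n A).injective h
    simp only [Fin.mk.injEq] at this
    omega
  have hd := lt_of_le_of_ne (not_lt.1 hcon) hne
  have hAal : Alphabet n A := fun j hj => hal j (by rw [h]; simp [hj])
  have hBal : Alphabet n B := fun j hj => hal j (by rw [h]; simp [hj])
  have k1 := len_le n A hAal
  have k2 := len_append_le n (A ++ [i]) B hBal
  have k3 : len (wprod n (A ++ [i])) ≤ len (wprod n A) := by
    rw [wprod_append, wprod_singleton, sTr_eq h1 h2]
    apply len_mul_swap_le_of_descent _ _ hd
    simp only
    omega
  have k4 : A ++ [i] ++ B = R := by rw [h]; simp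
  rw [k4, ← hl, h] at k2
  simp at k2
  omega

/-- Fin version of prefix inversions. -/
def PInv (n : ℕ) (R : List ℕ) (a b : Fin n) (k : ℕ) : Prop :=
  (wprod n (R.take k))⁻¹ b < (wprod n (R.take k))⁻¹ a

noncomputable def tauF (n : ℕ) (R : List ℕ) (a b : Fin n) : ℕ := sInf {k | PInv n R a b k}

lemma posOf_eq {n : ℕ} (x : Equiv.Perm (Fin n)) (a : Fin n) :
    posOf x (a.val + 1) = (x⁻¹ a).val + 1 := by
  unfold posOf app
  rw [dif_pos ⟨by omega, by omega⟩]
  simp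

lemma tau_eq (n : ℕ) (R : List ℕ) (a b : Fin n) :
    tau n R (a.val + 1) (b.val + 1) = tauF n R a b := by
  unfold tau tauF IsInversion PInv
  simp only [posOf_eq, Fin.lt_def, Nat.add_lt_add_iff_right]

lemma PInv_succ {n : ℕ} {R : List ℕ} (hR : IsReducedWord n R) {a b : Fin n} (hab : a < b) (k : ℕ)
    (h : PInv n R a b k) : PInv n R a b (k + 1) := by
  unfold PInv at *
  by_cases hk : k < R.length
  · have hi := hR.1 R[k] (List.getElem_mem hk)
    have hsplit : R = R.take k ++ R[k] :: R.drop (k + 1) := by simp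
    have hasc := ascent hR _ _ _ hsplit hi.1 hi.2
    have ht : R.take (k + 1) = R.take k ++ [R[k]] := by simp
    rw [ht, wprod_append, wprod_singleton, sTr_eq hi.1 hi.2, mul_inv_rev, Equiv.swap_inv,
      Equiv.Perm.mul_apply, Equiv.Perm.mul_apply]
    apply swap_lt _ h
    · rintro ⟨h1, h2⟩
      rw [← h1, ← h2] at hasc
      simp only [apply_inv_self_aux] at hasc
      exact absurd hab (not_lt.2 hasc.le)
    · simp only
      omega
  · rw [List.take_of_length_le (by omega)] at h ⊢
    exact h

lemma PInv_mono {n : ℕ} {R : List ℕ} (hR : IsReducedWord n R) {a b : Fin n} (hab : a < b)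
    {k l : ℕ} (hkl : k ≤ l) (h : PInv n R a b k) : PInv n R a b l := by
  induction hkl with
  | refl => exact h
  | step _ ih => exact PInv_succ hR hab _ ih

lemma tauF_eq_succ {n : ℕ} {R : List ℕ} (hR : IsReducedWord n R) {a b : Fin n} (hab : a < b)
    {k : ℕ} (h : ¬ PInv n R a b k) (h' : PInv n R a b (k + 1)) : tauF n R a b = k + 1 := by
  unfold tauF
  apply le_antisymm
  · exact Nat.sInf_le h'
  · apply le_csInf ⟨k + 1, h'⟩
    intro m hm
    by_contra hlt
    exact h (PInv_mono hR hab (by omega) hm)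

lemma PInv_length {n : ℕ} {R : List ℕ} (hR : wprod n R = w0 n) {a b : Fin n} (hab : a < b) :
    PInv n R a b R.length := by
  unfold PInv
  rw [List.take_length, hR]
  change Fin.rev b < Fin.rev a
  exact Fin.rev_lt_rev.2 hab

lemma tauF_ne_succ {n : ℕ} {R : List ℕ} (hR : wprod n R = w0 n) {a b : Fin n} (hab : a < b)
    {k : ℕ} (h : PInv n R a b (k + 1) → PInv n R a b k) : tauF n R a b ≠ k + 1 := by
  intro he
  have h1 : PInv n R a b (tauF n R a b) :=
    Nat.sInf_mem (s := {k | PInv n R a b k}) ⟨_, PInv_length hR hab⟩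
  rw [he] at h1
  have : tauF n R a b ≤ k := Nat.sInf_le (h h1)
  omega

set_option maxHeartbeats 1600000 in
/-- The statement for an explicit braid move. -/
lemma core (n : ℕ) (A B : List ℕ) (k : ℕ)
    (h₁ : IsReducedWordFor n (A ++ [k, k + 1, k] ++ B) (w0 n))
    (h₂ : IsReducedWordFor n (A ++ [k + 1, k, k + 1] ++ B) (w0 n)) :
    ∃! t : ℕ × ℕ × ℕ,
      (1 ≤ t.1 ∧ t.1 < t.2.1 ∧ t.2.1 < t.2.2 ∧ t.2.2 ≤ n) ∧
        T n (A ++ [k, k + 1, k] ++ B) t.1 t.2.1 t.2.2 ≠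
          T n (A ++ [k + 1, k, k + 1] ++ B) t.1 t.2.1 t.2.2 := by
  have hk1 : 1 ≤ k := (h₁.1.1 k (by simp)).1
  have hk2 : k + 1 < n := (h₁.1.1 (k + 1) (by simp)).2
  set R₁ := A ++ [k, k + 1, k] ++ B with hR₁
  set R₂ := A ++ [k + 1, k, k + 1] ++ B with hR₂
  obtain ⟨e, he⟩ : ∃ e : Fin n, e = ⟨k - 1, by omega⟩ := ⟨_, rfl⟩
  obtain ⟨f, hf⟩ : ∃ f : Fin n, f = ⟨k, by omega⟩ := ⟨_, rfl⟩
  obtain ⟨g, hg⟩ : ∃ g : Fin n, g = ⟨k + 1, hk2⟩ := ⟨_, rfl⟩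
  have hef : f.val = e.val + 1 := by rw [he, hf]; simp only; omega
  have hfg : g.val = f.val + 1 := by rw [hf, hg]
  have hs1 : sTr n k = Equiv.swap e f := by rw [sTr_eq hk1 (by omega), he, hf]
  have hs2 : sTr n (k + 1) = Equiv.swap f g := by
    rw [sTr_eq (by omega) hk2, hf, hg]; simp
  obtain ⟨u, hu⟩ : ∃ u, u = wprod n A := ⟨_, rfl⟩
  have huef : u e < u f := by
    have := ascent h₁.1 A ([k + 1, k] ++ B) k (by simp [hR₁]) hk1 (by omega)
    rwa [← he, ← hf, ← hu] at this
  have hufg : u f < u g := by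
    have := ascent h₂.1 A ([k, k + 1] ++ B) (k + 1) (by simp [hR₂]) (by omega) hk2
    simp only [Nat.add_sub_cancel] at this
    rwa [← hg, ← hf, ← hu] at this
  have hueg := huef.trans hufg
  have hne1 : e ≠ f := by intro h; rw [h] at hef; omega
  have hne2 : f ≠ g := by intro h; rw [h] at hfg; omega
  have hne3 : e ≠ g := by intro h; rw [h] at hef; omega
  -- prefixes
  have hlow : ∀ m ≤ A.length, R₁.take m = R₂.take m := by
    intro m hm
    simp only [hR₁, hR₂, List.append_assoc, List.take_append_of_le_length hm]
  have hbr : wprod n [k, k + 1, k] = wprod n [k + 1, k, k + 1] := by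
    have hx := braid_swap hne1 hne2 hne3
    simpa [wprod, hs1, hs2] using hx
  have hhigh : ∀ m, A.length + 3 ≤ m → wprod n (R₁.take m) = wprod n (R₂.take m) := by
    intro m hm
    obtain ⟨j, rfl⟩ : ∃ j, m = A.length + (3 + j) := ⟨m - A.length - 3, by omega⟩
    have e1 : R₁.take (A.length + (3 + j)) = A ++ ([k, k + 1, k] ++ B.take j) := by
      rw [hR₁, List.append_assoc, List.take_length_add_append, add_comm 3 j]
      simp
    have e2 : R₂.take (A.length + (3 + j)) = A ++ ([k + 1, k, k + 1] ++ B.take j) := by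
      rw [hR₂, List.append_assoc, List.take_length_add_append, add_comm 3 j]
      simp
    rw [e1, e2]
    simp only [wprod_append, hbr]
  have p0 : ∀ a b, PInv n R₁ a b A.length ↔ u⁻¹ b < u⁻¹ a := by
    intro a b
    unfold PInv
    rw [hR₁, List.append_assoc, List.take_left, hu]
  have q0 : ∀ a b, PInv n R₂ a b A.length ↔ u⁻¹ b < u⁻¹ a := by
    intro a b
    unfold PInv
    rw [hR₂, List.append_assoc, List.take_left, hu]
  have p1 : ∀ a b, PInv n R₁ a b (A.length + 1) ↔
      Equiv.swap e f (u⁻¹ b) < Equiv.swap e f (u⁻¹ a) := by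
    intro a b
    unfold PInv
    rw [hR₁, List.append_assoc, List.take_length_add_append]
    simp [hu, wprod, hs1, hs2]
  have p2 : ∀ a b, PInv n R₁ a b (A.length + 1 + 1) ↔
      Equiv.swap f g (Equiv.swap e f (u⁻¹ b)) < Equiv.swap f g (Equiv.swap e f (u⁻¹ a)) := by
    intro a b
    unfold PInv
    rw [hR₁, List.append_assoc, add_assoc, List.take_length_add_append]
    simp [hu, wprod, hs1, hs2]
  have p3 : ∀ a b, PInv n R₁ a b (A.length + 1 + 1 + 1) ↔
      Equiv.swap e f (Equiv.swap f g (Equiv.swap e f (u⁻¹ b))) <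
        Equiv.swap e f (Equiv.swap f g (Equiv.swap e f (u⁻¹ a))) := by
    intro a b
    unfold PInv
    rw [hR₁, List.append_assoc, add_assoc, add_assoc, List.take_length_add_append]
    simp [hu, wprod, hs1, hs2]
  have q1 : ∀ a b, PInv n R₂ a b (A.length + 1) ↔
      Equiv.swap f g (u⁻¹ b) < Equiv.swap f g (u⁻¹ a) := by
    intro a b
    unfold PInv
    rw [hR₂, List.append_assoc, List.take_length_add_append]
    simp [hu, wprod, hs1, hs2]
  have q2 : ∀ a b, PInv n R₂ a b (A.length + 1 + 1) ↔
      Equiv.swap e f (Equiv.swap f g (u⁻¹ b)) < Equiv.swap e f (Equiv.swap f g (u⁻¹ a)) := by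
    intro a b
    unfold PInv
    rw [hR₂, List.append_assoc, add_assoc, List.take_length_add_append]
    simp [hu, wprod, hs1, hs2]
  have q3 : ∀ a b, PInv n R₂ a b (A.length + 1 + 1 + 1) ↔
      Equiv.swap f g (Equiv.swap e f (Equiv.swap f g (u⁻¹ b))) <
        Equiv.swap f g (Equiv.swap e f (Equiv.swap f g (u⁻¹ a))) := by
    intro a b
    unfold PInv
    rw [hR₂, List.append_assoc, add_assoc, add_assoc, List.take_length_add_append]
    simp [hu, wprod, hs1, hs2]
  have sef_e : Equiv.swap e f e = f := Equiv.swap_apply_left _ _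
  have sef_f : Equiv.swap e f f = e := Equiv.swap_apply_right _ _
  have sef_g : Equiv.swap e f g = g := Equiv.swap_apply_of_ne_of_ne hne3.symm hne2.symm
  have sfg_e : Equiv.swap f g e = e := Equiv.swap_apply_of_ne_of_ne hne1 hne3
  have sfg_f : Equiv.swap f g f = g := Equiv.swap_apply_left _ _
  have sfg_g : Equiv.swap f g g = f := Equiv.swap_apply_right _ _
  -- special pairs
  have t1ef : tauF n R₁ (u e) (u f) = A.length + 1 := by
    apply tauF_eq_succ h₁.1 huef
    · rw [p0]; simp only [inv_apply_self_aux, sef_e, sef_f, sef_g, sfg_e, sfg_f, sfg_g, Fin.lt_def]; omega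
    · rw [p1]; simp only [inv_apply_self_aux, sef_e, sef_f, sef_g, sfg_e, sfg_f, sfg_g, Fin.lt_def]; omega
  have t1eg : tauF n R₁ (u e) (u g) = A.length + 1 + 1 := by
    apply tauF_eq_succ h₁.1 hueg
    · rw [p1]; simp only [inv_apply_self_aux, sef_e, sef_f, sef_g, sfg_e, sfg_f, sfg_g, Fin.lt_def]; omega
    · rw [p2]; simp only [inv_apply_self_aux, sef_e, sef_f, sef_g, sfg_e, sfg_f, sfg_g, Fin.lt_def]; omega
  have t1fg : tauF n R₁ (u f) (u g) = A.length + 1 + 1 + 1 := by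
    apply tauF_eq_succ h₁.1 hufg
    · rw [p2]; simp only [inv_apply_self_aux, sef_e, sef_f, sef_g, sfg_e, sfg_f, sfg_g, Fin.lt_def]; omega
    · rw [p3]; simp only [inv_apply_self_aux, sef_e, sef_f, sef_g, sfg_e, sfg_f, sfg_g, Fin.lt_def]; omega
  have t2fg : tauF n R₂ (u f) (u g) = A.length + 1 := by
    apply tauF_eq_succ h₂.1 hufg
    · rw [q0]; simp only [inv_apply_self_aux, sef_e, sef_f, sef_g, sfg_e, sfg_f, sfg_g, Fin.lt_def]; omega
    · rw [q1]; simp only [inv_apply_self_aux, sef_e, sef_f, sef_g, sfg_e, sfg_f, sfg_g, Fin.lt_def]; omega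
  have t2eg : tauF n R₂ (u e) (u g) = A.length + 1 + 1 := by
    apply tauF_eq_succ h₂.1 hueg
    · rw [q1]; simp only [inv_apply_self_aux, sef_e, sef_f, sef_g, sfg_e, sfg_f, sfg_g, Fin.lt_def]; omega
    · rw [q2]; simp only [inv_apply_self_aux, sef_e, sef_f, sef_g, sfg_e, sfg_f, sfg_g, Fin.lt_def]; omega
  have t2ef : tauF n R₂ (u e) (u f) = A.length + 1 + 1 + 1 := by
    apply tauF_eq_succ h₂.1 huef
    · rw [q2]; simp only [inv_apply_self_aux, sef_e, sef_f, sef_g, sfg_e, sfg_f, sfg_g, Fin.lt_def]; omega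
    · rw [q3]; simp only [inv_apply_self_aux, sef_e, sef_f, sef_g, sfg_e, sfg_f, sfg_g, Fin.lt_def]; omega
  -- other pairs
  have other : ∀ a b : Fin n, a < b → ¬ (a = u e ∧ b = u f) → ¬ (a = u e ∧ b = u g) →
      ¬ (a = u f ∧ b = u g) → tauF n R₁ a b = tauF n R₂ a b ∧
        (tauF n R₁ a b ≤ A.length ∨ A.length + 3 < tauF n R₁ a b) := by
    intro a b hab n1 n2 n3
    have m1 : ¬ (a = u f ∧ b = u e) := by
      rintro ⟨rfl, rfl⟩; exact absurd hab (not_lt.2 huef.le)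
    have m2 : ¬ (a = u g ∧ b = u e) := by
      rintro ⟨rfl, rfl⟩; exact absurd hab (not_lt.2 hueg.le)
    have m3 : ¬ (a = u g ∧ b = u f) := by
      rintro ⟨rfl, rfl⟩; exact absurd hab (not_lt.2 hufg.le)
    have P1 := p0 a b
    have P2 := p1 a b
    have P3 := p2 a b
    have P4 := p3 a b
    have Q1 := q0 a b
    have Q2 := q1 a b
    have Q3 := q2 a b
    have hnab : u⁻¹ a ≠ u⁻¹ b := fun h => hab.ne (u⁻¹.injective h)
    obtain ⟨x, rfl⟩ : ∃ x, a = u x := ⟨u⁻¹ a, by simp⟩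
    obtain ⟨y, rfl⟩ : ∃ y, b = u y := ⟨u⁻¹ b, by simp⟩
    simp only [inv_apply_self_aux, EmbeddingLike.apply_eq_iff_eq] at *
    have n1' : ¬ (y = e ∧ x = f) := fun h => m1 ⟨h.2, h.1⟩
    have n2' : ¬ (y = e ∧ x = g) := fun h => m2 ⟨h.2, h.1⟩
    have n3' : ¬ (y = f ∧ x = g) := fun h => m3 ⟨h.2, h.1⟩
    have m1' : ¬ (y = f ∧ x = e) := fun h => n1 ⟨h.2, h.1⟩
    have m2' : ¬ (y = g ∧ x = e) := fun h => n2 ⟨h.2, h.1⟩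
    have m3' : ¬ (y = g ∧ x = f) := fun h => n3 ⟨h.2, h.1⟩
    have w1 := swap_lt_iff hef n1' m1'
    have w2 := swap_lt_iff hfg n3' m3'
    have w3 := swap_lt_iff_two hef hfg n1' m1' n2' m2'
    have w4 := swap_lt_iff_two_rev hef hfg n3' m3' n2' m2'
    have w5 := swap_lt_iff_three hef hfg n1' m1' n2' m2' n3' m3'
    rw [w1] at P2
    rw [w3] at P3
    rw [w5] at P4
    rw [w2] at Q2
    rw [w4] at Q3
    constructor
    · unfold tauF
      congr 1
      ext m
      simp only [Set.mem_setOf_eq]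
      rcases Nat.lt_or_ge A.length m with hm | hm
      · rcases Nat.lt_or_ge m (A.length + 3) with hm' | hm'
        · obtain rfl | rfl : m = A.length + 1 ∨ m = A.length + 1 + 1 := by omega
          · rw [P2, Q2]
          · rw [P3, Q3]
        · unfold PInv
          rw [hhigh m hm']
      · unfold PInv
        rw [hlow m hm]
    · have r1 := tauF_ne_succ h₁.2 hab (P2.trans P1.symm).1
      have r2 := tauF_ne_succ h₁.2 hab (P3.trans P2.symm).1
      have r3 := tauF_ne_succ h₁.2 hab (P4.trans P3.symm).1
      omega
  have Tfin : ∀ (R : List ℕ) (a b c : Fin n), T n R (a.val + 1) (b.val + 1) (c.val + 1) =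
      if tauF n R a b < tauF n R b c then 1 else -1 := by
    intro R a b c
    unfold T
    rw [tau_eq, tau_eq]
  refine ⟨((u e).val + 1, (u f).val + 1, (u g).val + 1), ⟨⟨?_, ?_, ?_, ?_⟩, ?_⟩, ?_⟩
  · simp
  · simpa using huef
  · simpa using hufg
  · simp only; omega
  · simp only
    rw [Tfin, Tfin, t1ef, t1fg, t2ef, t2fg, if_pos (by omega), if_neg (by omega)]
    norm_num
  · rintro ⟨a, b, c⟩ ⟨⟨ha, hab, hbc, hc⟩, hT⟩
    simp only at ha hab hbc hc hT
    obtain ⟨a, rfl⟩ : ∃ a' : Fin n, a = a'.val + 1 := ⟨⟨a - 1, by omega⟩, by simp only; omega⟩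
    obtain ⟨b, rfl⟩ : ∃ b' : Fin n, b = b'.val + 1 := ⟨⟨b - 1, by omega⟩, by simp only; omega⟩
    obtain ⟨c, rfl⟩ : ∃ c' : Fin n, c = c'.val + 1 := ⟨⟨c - 1, by omega⟩, by simp only; omega⟩
    have hab' : a < b := by simpa using hab
    have hbc' : b < c := by simpa using hbc
    rw [Tfin, Tfin] at hT
    by_contra hne
    apply hT
    have range : ∀ x y : Fin n, x < y →
        (tauF n R₁ x y = tauF n R₂ x y ∧
          (tauF n R₁ x y ≤ A.length ∨ A.length + 3 < tauF n R₁ x y)) ∨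
        (((x = u e ∧ y = u f) ∨ (x = u e ∧ y = u g) ∨ (x = u f ∧ y = u g)) ∧
          (A.length < tauF n R₁ x y ∧ tauF n R₁ x y ≤ A.length + 3) ∧
          (A.length < tauF n R₂ x y ∧ tauF n R₂ x y ≤ A.length + 3)) := by
      intro x y hxy
      by_cases c1 : x = u e ∧ y = u f
      · right; refine ⟨Or.inl c1, ?_⟩; rw [c1.1, c1.2, t1ef, t2ef]; omega
      by_cases c2 : x = u e ∧ y = u g
      · right; refine ⟨Or.inr (Or.inl c2), ?_⟩; rw [c2.1, c2.2, t1eg, t2eg]; omega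
      by_cases c3 : x = u f ∧ y = u g
      · right; refine ⟨Or.inr (Or.inr c3), ?_⟩; rw [c3.1, c3.2, t1fg, t2fg]; omega
      exact Or.inl (other x y hxy c1 c2 c3)
    have hiff : tauF n R₁ a b < tauF n R₁ b c ↔ tauF n R₂ a b < tauF n R₂ b c := by
      rcases range a b hab' with r | ⟨s, r⟩
      · rcases range b c hbc' with r' | ⟨s', r'⟩ <;> omega
      · rcases range b c hbc' with r' | ⟨s', r'⟩
        · omega
        · exfalso
          apply hne
          have i1 : u e ≠ u f := huef.ne
          have i2 : u f ≠ u g := hufg.ne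
          have i3 : u e ≠ u g := hueg.ne
          rcases s with ⟨rfl, rfl⟩ | ⟨rfl, rfl⟩ | ⟨rfl, rfl⟩ <;>
            rcases s' with ⟨h, rfl⟩ | ⟨h, rfl⟩ | ⟨h, rfl⟩ <;>
            first
              | rfl
              | exact absurd h i1
              | exact absurd h i2
              | exact absurd h i3
              | exact absurd h.symm i1
              | exact absurd h.symm i2
              | exact absurd h.symm i3
    simp only [hiff]

/-- If two reduced words `R₁, R₂` for the longest element
`w₀ ∈ S_n` differ by a single braid move, then there is exactly one triple
`(a,b,c)` with `1 ≤ a < b < c ≤ n` such that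
`T_{R₁}(a,b,c) ≠ T_{R₂}(a,b,c)`; for all other triples the values agree. -/
theorem braidMove_flips_exactly_one_T
    (n : ℕ) (hn : 2 ≤ n) (R₁ R₂ : List ℕ)
    (h₁ : IsReducedWordFor n R₁ (w0 n)) (h₂ : IsReducedWordFor n R₂ (w0 n))
    (hbraid : BraidMove R₁ R₂ ∨ BraidMove R₂ R₁) :
    ∃! t : ℕ × ℕ × ℕ,
      (1 ≤ t.1 ∧ t.1 < t.2.1 ∧ t.2.1 < t.2.2 ∧ t.2.2 ≤ n) ∧
        T n R₁ t.1 t.2.1 t.2.2 ≠ T n R₂ t.1 t.2.1 t.2.2 := by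
  rcases hbraid with ⟨A, B, k, rfl, rfl⟩ | ⟨A, B, k, rfl, rfl⟩
  · exact core n A B k h₁ h₂
  · simp only [ne_comm (a := T n (A ++ [k + 1, k, k + 1] ++ B) _ _ _)]
    exact core n A B k h₂ h₁

end BSDist
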